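/- arXiv:quant-ph/0503052 — 2 statements merged into one kernel-verified Lean document; each statement's English description precedes it below -/
import Mathlib

section
/- Let n = 2k+1 and |Ψ⟩ = |s⟩^{⊗k} ⊗ |0⟩ with |s⟩ = |01⟩ - |10⟩. For any X₁,…,X_k ∈ su(2) and any real t, the element (X₁,X₁,…,X_k,X_k, diag(it,-it)) of su(2)^n satisfies X·|Ψ⟩ = it|Ψ⟩. Hence the isotropy Lie algebra of the projective state [Ψ] has dimension at least 3k+1 = (3n-1)/2. -/
open Matrix

/-- The Lie algebra action of an `n`-tuple of 2×2 matrices on `(ℂ²)^{⊗n}`,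
in coordinates: `X` acts as the sum over `k` of `X_k` applied to
the `k`-th tensor factor. -/
noncomputable def lieAct {n : ℕ} (X : Fin n → Matrix (Fin 2) (Fin 2) ℂ)
    (ψ : (Fin n → Fin 2) → ℂ) : (Fin n → Fin 2) → ℂ :=
  fun I => ∑ k, ∑ j : Fin 2, X k (I k) j * ψ (Function.update I k j)

/-- Coefficients of the singlet `|s⟩ = |01⟩ - |10⟩`. -/
noncomputable def singletC (a b : Fin 2) : ℂ :=
  if a = 0 ∧ b = 1 then 1 else if a = 1 ∧ b = 0 then -1 else 0

/-- Membership in `su(2)`: traceless and skew-Hermitian. -/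
def IsSu2 (X : Matrix (Fin 2) (Fin 2) ℂ) : Prop := X.trace = 0 ∧ Xᴴ = -X

/-- `|s⟩^{⊗k} ⊗ |0⟩ ∈ (ℂ²)^{⊗(2k+1)}`, in coordinates. -/
noncomputable def singProdOdd (k : ℕ) : (Fin (2 * k + 1) → Fin 2) → ℂ :=
  fun I => (∏ j : Fin k,
    singletC (I ⟨2 * j.val, by have := j.isLt; omega⟩)
             (I ⟨2 * j.val + 1, by have := j.isLt; omega⟩)) *
    (if I ⟨2 * k, by omega⟩ = 0 then 1 else 0)

theorem sum_pairs (k : ℕ) (f : Fin (2 * k + 1) → ℂ) :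
    ∑ i, f i = (∑ j : Fin k, (f ⟨2 * j.val, by have := j.isLt; omega⟩ +
      f ⟨2 * j.val + 1, by have := j.isLt; omega⟩)) + f ⟨2 * k, by omega⟩ := by
  have key : ∀ (g : ℕ → ℂ) (k : ℕ), ∑ i ∈ Finset.range (2 * k + 1), g i =
      (∑ j ∈ Finset.range k, (g (2 * j) + g (2 * j + 1))) + g (2 * k) := by
    intro g k
    induction k with
    | zero => simp
    | succ k ih =>
      rw [show 2 * (k + 1) + 1 = (2 * k + 1) + 1 + 1 by ring, Finset.sum_range_succ,
        Finset.sum_range_succ, ih, Finset.sum_range_succ]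
      rw [show 2 * (k + 1) = (2 * k + 1) + 1 by ring]
      ring
  have h := key (fun n => if h : n < 2 * k + 1 then f ⟨n, h⟩ else 0) k
  rw [Finset.sum_range, Finset.sum_range] at h
  have e1 : ∀ j : Fin k, 2 * j.val < 2 * k + 1 := fun j => by have := j.isLt; omega
  have e2 : ∀ j : Fin k, 2 * j.val < 2 * k := fun j => by have := j.isLt; omega
  have e3 : ∀ j : Fin k, 2 * j.val + 1 < 2 * k + 1 := fun j => by have := j.isLt; omega
  simp only [e1, e3, Fin.is_lt, Fin.eta, dite_true, lt_add_iff_pos_right, zero_lt_one] at h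
  exact h

theorem singlet_inv (X : Matrix (Fin 2) (Fin 2) ℂ) (hX : X.trace = 0) (a b : Fin 2) :
    (∑ c, X a c * singletC c b) + ∑ c, X b c * singletC a c = 0 := by
  rw [Matrix.trace_fin_two] at hX
  fin_cases a <;> fin_cases b <;> simp [singletC] <;> first | linear_combination hX | linear_combination -hX

theorem prod_update_even (k : ℕ) (I : Fin (2 * k + 1) → Fin 2) (j : Fin k) (c : Fin 2) :
    singProdOdd k (Function.update I ⟨2 * j.val, by have := j.isLt; omega⟩ c) =
    singletC c (I ⟨2 * j.val + 1, by have := j.isLt; omega⟩) *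
    ((∏ l ∈ Finset.univ.erase j,
    singletC (I ⟨2 * l.val, by have := l.isLt; omega⟩)
             (I ⟨2 * l.val + 1, by have := l.isLt; omega⟩)) *
    (if I ⟨2 * k, by omega⟩ = 0 then 1 else 0)) := by
  unfold singProdOdd
  rw [← Finset.mul_prod_erase _ _ (Finset.mem_univ j), mul_assoc]
  have hj := j.isLt
  congr 1
  · rw [Function.update_self, Function.update_of_ne (by simp)]
  · congr 1
    · refine Finset.prod_congr rfl fun l hl => ?_
      have hl' : l.val ≠ j.val := fun h => (Finset.ne_of_mem_erase hl) (Fin.ext h)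
      rw [Function.update_of_ne (by simp only [ne_eq, Fin.mk.injEq]; omega),
        Function.update_of_ne (by simp only [ne_eq, Fin.mk.injEq]; omega)]
    · rw [Function.update_of_ne (by simp only [ne_eq, Fin.mk.injEq]; omega)]

theorem prod_update_odd (k : ℕ) (I : Fin (2 * k + 1) → Fin 2) (j : Fin k) (c : Fin 2) :
    singProdOdd k (Function.update I ⟨2 * j.val + 1, by have := j.isLt; omega⟩ c) =
    singletC (I ⟨2 * j.val, by have := j.isLt; omega⟩) c *
    ((∏ l ∈ Finset.univ.erase j,
    singletC (I ⟨2 * l.val, by have := l.isLt; omega⟩)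
             (I ⟨2 * l.val + 1, by have := l.isLt; omega⟩)) *
    (if I ⟨2 * k, by omega⟩ = 0 then 1 else 0)) := by
  unfold singProdOdd
  rw [← Finset.mul_prod_erase _ _ (Finset.mem_univ j), mul_assoc]
  have hj := j.isLt
  congr 1
  · rw [Function.update_self, Function.update_of_ne (by simp)]
  · congr 1
    · refine Finset.prod_congr rfl fun l hl => ?_
      have hl' : l.val ≠ j.val := fun h => (Finset.ne_of_mem_erase hl) (Fin.ext h)
      rw [Function.update_of_ne (by simp only [ne_eq, Fin.mk.injEq]; omega),
        Function.update_of_ne (by simp only [ne_eq, Fin.mk.injEq]; omega)]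
    · rw [Function.update_of_ne (by simp only [ne_eq, Fin.mk.injEq]; omega)]

theorem prod_update_last (k : ℕ) (I : Fin (2 * k + 1) → Fin 2) (c : Fin 2) :
    singProdOdd k (Function.update I ⟨2 * k, by omega⟩ c) =
    (∏ l : Fin k,
    singletC (I ⟨2 * l.val, by have := l.isLt; omega⟩)
             (I ⟨2 * l.val + 1, by have := l.isLt; omega⟩)) *
    (if c = 0 then 1 else 0) := by
  unfold singProdOdd
  congr 1
  · refine Finset.prod_congr rfl fun l _ => ?_
    have hl := l.isLt
    rw [Function.update_of_ne (by simp only [ne_eq, Fin.mk.injEq]; omega),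
      Function.update_of_ne (by simp only [ne_eq, Fin.mk.injEq]; omega)]
  · rw [Function.update_self]

/-- The index of the pair containing position `i`. -/
def halfIdx (k i : ℕ) (h : i < 2 * k) : Fin k := ⟨i / 2, by omega⟩

theorem act_aux (k : ℕ)
    (X : Fin k → Matrix (Fin 2) (Fin 2) ℂ) (hX : ∀ j, IsSu2 (X j)) (t : ℝ) :
    lieAct (fun i : Fin (2 * k + 1) =>
        if h : i.val < 2 * k then X (halfIdx k i.val h)
        else !![Complex.I * t, 0; 0, -(Complex.I * t)])
        (singProdOdd k) = (Complex.I * t) • singProdOdd k := by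
  funext I
  unfold lieAct
  rw [sum_pairs, Finset.sum_eq_zero, zero_add]
  · simp only [prod_update_last, lt_irrefl, dite_false, Pi.smul_apply, smul_eq_mul]
    unfold singProdOdd
    generalize I ⟨2 * k, _⟩ = a
    fin_cases a <;> simp
  · intro j _
    have hj := j.isLt
    have h1 : 2 * j.val < 2 * k := by omega
    have h2 : 2 * j.val + 1 < 2 * k := by omega
    have d1 : 2 * j.val / 2 = j.val := by omega
    have d2 : (2 * j.val + 1) / 2 = j.val := by omega
    simp only [halfIdx, prod_update_even, prod_update_odd, h1, h2, dite_true, d1, d2, Fin.eta,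
      ← mul_assoc, ← Finset.sum_mul, ← add_mul]
    rw [singlet_inv _ (hX j).1, zero_mul, zero_mul]

/-- The parametrization of `su(2)` by three real numbers. -/
noncomputable def su2Mat (a b c : ℝ) : Matrix (Fin 2) (Fin 2) ℂ :=
  !![Complex.I * a, b + Complex.I * c; -b + Complex.I * c, -(Complex.I * a)]

theorem su2Mat_isSu2 (a b c : ℝ) : IsSu2 (su2Mat a b c) := by
  refine ⟨by simp [su2Mat, Matrix.trace_fin_two], ?_⟩
  ext i j
  fin_cases i <;> fin_cases j <;> simp [su2Mat] <;> ring

theorem su2Mat_zero {a b c : ℝ} (h : su2Mat a b c = 0) : a = 0 ∧ b = 0 ∧ c = 0 := by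
  have h0 := congrFun (congrFun h 0) 0
  have h1 := congrFun (congrFun h 0) 1
  have e1 := congrArg Complex.re h1
  have e2 := congrArg Complex.im h1
  simp [su2Mat] at h0 e1 e2
  exact ⟨h0, e1, e2⟩

/-- The isotropy elements, parametrized linearly. -/
noncomputable def isoMap (k : ℕ) :
    (Fin (3 * k + 1) → ℝ) →ₗ[ℝ] (Fin (2 * k + 1) → Matrix (Fin 2) (Fin 2) ℂ) where
  toFun v := fun i =>
    if h : i.val < 2 * k then
      (fun j : Fin k => su2Mat (v ⟨3 * j.val, by have := j.isLt; omega⟩)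
        (v ⟨3 * j.val + 1, by have := j.isLt; omega⟩)
        (v ⟨3 * j.val + 2, by have := j.isLt; omega⟩)) (halfIdx k i.val h)
    else !![Complex.I * (v ⟨3 * k, by omega⟩ : ℝ), 0; 0, -(Complex.I * (v ⟨3 * k, by omega⟩ : ℝ))]
  map_add' v w := by
    funext i
    simp only [Pi.add_apply]
    split_ifs <;> ext a b <;> fin_cases a <;> fin_cases b <;> simp [su2Mat] <;> ring
  map_smul' r v := by
    funext i
    simp only [Pi.smul_apply, RingHom.id_apply]
    split_ifs <;> ext a b <;> fin_cases a <;> fin_cases b <;> simp [su2Mat] <;> ring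

theorem isoMap_act (k : ℕ) (v : Fin (3 * k + 1) → ℝ) :
    lieAct (isoMap k v) (singProdOdd k) =
      (Complex.I * (v ⟨3 * k, by omega⟩ : ℝ)) • singProdOdd k :=
  act_aux k (fun j : Fin k => su2Mat (v ⟨3 * j.val, by have := j.isLt; omega⟩)
        (v ⟨3 * j.val + 1, by have := j.isLt; omega⟩)
        (v ⟨3 * j.val + 2, by have := j.isLt; omega⟩))
    (fun j => su2Mat_isSu2 _ _ _) (v ⟨3 * k, by omega⟩)

theorem isoMap_ker (k : ℕ) : LinearMap.ker (isoMap k) = ⊥ := by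
  rw [LinearMap.ker_eq_bot']
  intro v hv
  funext m
  have hm := m.isLt
  by_cases hk : m.val = 3 * k
  · have h := congrFun (congrFun (congrFun hv ⟨2 * k, by omega⟩) 0) 0
    simp [isoMap] at h
    rw [show m = ⟨3 * k, by omega⟩ from Fin.ext hk]
    simpa using h
  · have h := congrFun hv ⟨2 * (m.val / 3), by omega⟩
    have h1 : 2 * (m.val / 3) < 2 * k := by omega
    have d1 : 2 * (m.val / 3) / 2 = m.val / 3 := by omega
    simp only [isoMap, halfIdx, LinearMap.coe_mk, AddHom.coe_mk, h1, dite_true, d1, Pi.zero_apply] at h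
    obtain ⟨ha, hb, hc⟩ := su2Mat_zero h
    have : m.val = 3 * (m.val / 3) ∨ m.val = 3 * (m.val / 3) + 1 ∨
      m.val = 3 * (m.val / 3) + 2 := by omega
    rcases this with e | e | e
    · exact (congrArg v (Fin.ext e)).trans ha
    · exact (congrArg v (Fin.ext e)).trans hb
    · exact (congrArg v (Fin.ext e)).trans hc

/-- For `n = 2k+1`, elements `(X₁,X₁,…,X_k,X_k, diag(it,-it))`
of `su(2)^n` act on `|s⟩^{⊗k} ⊗ |0⟩` as multiplication by `it`; hence the
isotropy Lie algebra of the projective state has dimension at least `3k+1`. -/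
theorem singlet_product_qubit_isotropy (k : ℕ)
    (X : Fin k → Matrix (Fin 2) (Fin 2) ℂ) (hX : ∀ j, IsSu2 (X j)) (t : ℝ) :
    lieAct (fun i : Fin (2 * k + 1) =>
        if h : i.val < 2 * k then X ⟨i.val / 2, by omega⟩
        else !![Complex.I * t, 0; 0, -(Complex.I * t)])
        (singProdOdd k) = (Complex.I * t) • singProdOdd k ∧
    ∃ Y : Fin (3 * k + 1) → (Fin (2 * k + 1) → Matrix (Fin 2) (Fin 2) ℂ),
      LinearIndependent ℝ Y ∧
      ∀ m, (∀ i, IsSu2 (Y m i)) ∧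
        ∃ θ : ℝ, lieAct (Y m) (singProdOdd k) = (Complex.I * θ) • singProdOdd k := by
  refine ⟨act_aux k X hX t, fun m => isoMap k (Pi.basisFun ℝ _ m), ?_, ?_⟩
  · exact (Pi.basisFun ℝ (Fin (3 * k + 1))).linearIndependent.map' (isoMap k) (isoMap_ker k)
  · intro m
    refine ⟨?_, _, isoMap_act k _⟩
    intro i
    simp only [isoMap, LinearMap.coe_mk, AddHom.coe_mk]
    split_ifs
    · exact su2Mat_isSu2 _ _ _
    · generalize Pi.basisFun ℝ (Fin (3 * k + 1)) m _ = a
      simpa [su2Mat] using su2Mat_isSu2 a 0 0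
end

section
/- For the action of SU(2)^n on projective n-qubit state space ℙ((ℂ²)^{⊗n}), the minimum orbit dimension over all states equals 3n/2 if n is even and (3n+1)/2 if n is odd. Equivalently, for every nonzero ψ ∈ (ℂ²)^{⊗n}, the real matrix M whose columns are A₁ψ, B₁ψ, C₁ψ, …, A_nψ, B_nψ, C_nψ, -iψ (viewed in ℝ^{2^{n+1}}) satisfies rank M ≥ 3n/2 + 1 for n even and rank M ≥ (3n+1)/2 + 1 for n odd, with equality attained by products of singlets (tensored with |0⟩ when n is odd). -/
open Matrix

/-- Flip the `k`-th bit of a multi-index. -/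
def bitFlip {n : ℕ} (k : Fin n) (I : Fin n → Fin 2) : Fin n → Fin 2 :=
  Function.update I k (1 - I k)

/-- `A_k|ψ⟩ = ∑_I i (-1)^(i_k) c_I |I⟩`. -/
noncomputable def Aop {n : ℕ} (k : Fin n) (ψ : (Fin n → Fin 2) → ℂ) :
    (Fin n → Fin 2) → ℂ :=
  fun I => Complex.I * (-1 : ℂ) ^ ((I k : ℕ)) * ψ I

/-- `B_k|ψ⟩ = ∑_I (-1)^(i_k) c_{I_k} |I⟩`. -/
noncomputable def Bop {n : ℕ} (k : Fin n) (ψ : (Fin n → Fin 2) → ℂ) :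
    (Fin n → Fin 2) → ℂ :=
  fun I => (-1 : ℂ) ^ ((I k : ℕ)) * ψ (bitFlip k I)

/-- `C_k|ψ⟩ = ∑_I i c_{I_k} |I⟩`. -/
noncomputable def Cop {n : ℕ} (k : Fin n) (ψ : (Fin n → Fin 2) → ℂ) :
    (Fin n → Fin 2) → ℂ :=
  fun I => Complex.I * ψ (bitFlip k I)

/-- The columns of the matrix `M`, as complex vectors:
`A₁ψ, B₁ψ, C₁ψ, …, A_nψ, B_nψ, C_nψ, -iψ`. -/
noncomputable def colM {n : ℕ} (ψ : (Fin n → Fin 2) → ℂ) :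
    (Fin n × Fin 3) ⊕ Unit → ((Fin n → Fin 2) → ℂ) :=
  fun c => match c with
  | Sum.inl (k, c) =>
      if c = 0 then Aop k ψ else if c = 1 then Bop k ψ else Cop k ψ
  | Sum.inr _ => fun I => -(Complex.I * ψ I)

/-- The real `2^(n+1) × (3n+1)` matrix `M` associated to a state vector `ψ`,
whose columns are the real vectors corresponding to
`A₁ψ, B₁ψ, C₁ψ, …, A_nψ, B_nψ, C_nψ, -iψ`. -/
noncomputable def Mmat {n : ℕ} (ψ : (Fin n → Fin 2) → ℂ) :
    Matrix ((Fin n → Fin 2) × Fin 2) ((Fin n × Fin 3) ⊕ Unit) ℝ :=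
  Matrix.of fun p c => if p.2 = 0 then (colM ψ c p.1).re else (colM ψ c p.1).im

/-- The product of `⌊n/2⌋` singlets, tensored with `|0⟩` when `n` is odd. -/
noncomputable def singState (n : ℕ) : (Fin n → Fin 2) → ℂ :=
  fun I => (∏ j : Fin (n / 2),
    singletC (I ⟨2 * j.val, by have := j.isLt; omega⟩)
             (I ⟨2 * j.val + 1, by have := j.isLt; omega⟩)) *
    (if h : n % 2 = 1 then (if I ⟨n - 1, by omega⟩ = 0 then 1 else 0) else 1)


lemma cr_eq_zero_iff (v w : Fin 3 → ℝ) : v ⨯₃ w = 0 ↔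
    v 1 * w 2 = v 2 * w 1 ∧ v 2 * w 0 = v 0 * w 2 ∧ v 0 * w 1 = v 1 * w 0 := by
  rw [cross_apply]
  constructor
  · intro h
    have h0 := congrFun h 0
    have h1 := congrFun h 1
    have h2 := congrFun h 2
    simp at h0 h1 h2
    refine ⟨by linarith, by linarith, by linarith⟩
  · rintro ⟨h0, h1, h2⟩
    ext i
    fin_cases i <;> simp <;> linarith

lemma cr_trans (v y y' : Fin 3 → ℝ) (hv : v ≠ 0) (h : v ⨯₃ y = 0) (h' : v ⨯₃ y' = 0) :
    y ⨯₃ y' = 0 := by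
  rw [cr_eq_zero_iff] at *
  obtain ⟨a, b, c⟩ := h
  obtain ⟨a', b', c'⟩ := h'
  have : v 0 ≠ 0 ∨ v 1 ≠ 0 ∨ v 2 ≠ 0 := by
    by_contra hc
    push Not at hc
    apply hv
    ext i
    fin_cases i <;> simp [hc]
  rcases this with h | h | h
  · refine ⟨?_, ?_, ?_⟩ <;> apply mul_left_cancel₀ (mul_ne_zero h h) <;> grind
  · refine ⟨?_, ?_, ?_⟩ <;> apply mul_left_cancel₀ (mul_ne_zero h h) <;> grind
  · refine ⟨?_, ?_, ?_⟩ <;> apply mul_left_cancel₀ (mul_ne_zero h h) <;> grind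

lemma dot_self_pos (v : Fin 3 → ℝ) (hv : v ≠ 0) : 0 < v 0 ^ 2 + v 1 ^ 2 + v 2 ^ 2 := by
  by_contra hc
  apply hv
  have h0 : v 0 = 0 := by nlinarith [sq_nonneg (v 0), sq_nonneg (v 1), sq_nonneg (v 2)]
  have h1 : v 1 = 0 := by nlinarith [sq_nonneg (v 0), sq_nonneg (v 1), sq_nonneg (v 2)]
  have h2 : v 2 = 0 := by nlinarith [sq_nonneg (v 0), sq_nonneg (v 1), sq_nonneg (v 2)]
  ext i
  fin_cases i <;> simp [h0, h1, h2]

/-- parallel vectors are multiples -/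
lemma cr_smul (v w : Fin 3 → ℝ) (hv : v ≠ 0) (h : v ⨯₃ w = 0) : ∃ c : ℝ, c • v = w := by
  have hp := dot_self_pos v hv
  rw [cr_eq_zero_iff] at h
  obtain ⟨a, b, c⟩ := h
  refine ⟨(v 0 * w 0 + v 1 * w 1 + v 2 * w 2) / (v 0 ^ 2 + v 1 ^ 2 + v 2 ^ 2), ?_⟩
  ext i
  fin_cases i <;> simp <;> field_simp <;> grind

lemma cr_cr_self (v y : Fin 3 → ℝ) (h : v ⨯₃ y ≠ 0) : v ⨯₃ (v ⨯₃ y) ≠ 0 := by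
  intro h'
  have hv : v ≠ 0 := by rintro rfl; simp at h
  obtain ⟨c, hc⟩ := cr_smul v _ hv h'
  have h1 : v ⬝ᵥ (v ⨯₃ y) = 0 := dot_self_cross v y
  rw [← hc] at h1
  have hp := dot_self_pos v hv
  simp [dotProduct, Fin.sum_univ_three] at h1
  have : c = 0 := by
    have : c * (v 0 ^ 2 + v 1 ^ 2 + v 2 ^ 2) = 0 := by linarith
    rcases mul_eq_zero.mp this with h | h
    · exact h
    · exact absurd h hp.ne'
  rw [this, zero_smul] at hc
  exact h hc.symm

lemma cr_cr_par (u v y : Fin 3 → ℝ) (hu : u ≠ 0) (huv : u ⨯₃ v = 0) (h : v ⨯₃ y ≠ 0) :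
    u ⨯₃ (v ⨯₃ y) ≠ 0 := by
  obtain ⟨c, rfl⟩ := cr_smul u v hu huv
  simp only [map_smul, LinearMap.smul_apply] at h ⊢
  have h2 : c ≠ 0 := by rintro rfl; simp at h
  have h3 : u ⨯₃ y ≠ 0 := by intro h4; simp [h4] at h
  exact smul_ne_zero h2 (cr_cr_self u y h3)

section
variable {ι : Type*} [Fintype ι] [DecidableEq ι]

/-- Elements of `L` supported on `S`. -/
def suppSub (L : Submodule ℝ (ι → Fin 3 → ℝ)) (S : Finset ι) : Submodule ℝ (ι → Fin 3 → ℝ) where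
  carrier := {x | x ∈ L ∧ ∀ k, k ∉ S → x k = 0}
  zero_mem' := ⟨L.zero_mem, fun _ _ => rfl⟩
  add_mem' := fun {a b} ha hb => ⟨L.add_mem ha.1 hb.1, fun k hk => by
    simp [ha.2 k hk, hb.2 k hk]⟩
  smul_mem' := fun c a ha => ⟨L.smul_mem c ha.1, fun k hk => by simp [ha.2 k hk]⟩

lemma finrank_step {W U : Type*} [AddCommGroup W] [Module ℝ W] [FiniteDimensional ℝ W]
    [AddCommGroup U] [Module ℝ U] [FiniteDimensional ℝ U] (f : W →ₗ[ℝ] U)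
    (V V' : Submodule ℝ W) (h : ∀ x ∈ V, f x = 0 → x ∈ V') :
    Module.finrank ℝ V ≤ Module.finrank ℝ (V.map f) + Module.finrank ℝ V' := by
  have h1 := LinearMap.finrank_range_add_finrank_ker (f.domRestrict V)
  rw [LinearMap.range_domRestrict] at h1
  have h2 : Module.finrank ℝ (LinearMap.ker (f.domRestrict V)) ≤ Module.finrank ℝ V' := by
    let g : LinearMap.ker (f.domRestrict V) →ₗ[ℝ] V' :=
      LinearMap.codRestrict V' (V.subtype ∘ₗ (LinearMap.ker (f.domRestrict V)).subtype)
        (fun x => h _ x.1.2 (LinearMap.mem_ker.mp x.2))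
    apply LinearMap.finrank_le_finrank_of_injective (f := g)
    intro x y hxy
    have := congrArg Subtype.val hxy
    exact Subtype.ext (Subtype.ext this)
  omega

lemma exists_link (L : Submodule ℝ (ι → Fin 3 → ℝ))
    (hbr : ∀ x ∈ L, ∀ y ∈ L, (fun k => x k ⨯₃ y k) ∈ L)
    (hno : ∀ k, ∀ x ∈ L, ∀ y ∈ L, (∀ j, j ≠ k → x j = 0) → (∀ j, j ≠ k → y j = 0) →
      x k ⨯₃ y k = 0)
    (k : ι) (y y' : ι → Fin 3 → ℝ) (hy : y ∈ L) (hy' : y' ∈ L) (hyy : y k ⨯₃ y' k ≠ 0)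
    (S : Finset ι) (hys : ∀ j, j ∉ S → y j = 0) :
    ∃ j ∈ S.erase k, ∀ x ∈ suppSub L S, x j = 0 → x k = 0 := by
  by_contra hc
  push Not at hc
  -- a vector moving any given one
  have mv : ∀ v : Fin 3 → ℝ, v ≠ 0 → ∃ z ∈ L, v ⨯₃ z k ≠ 0 := by
    intro v hv
    by_contra h
    push Not at h
    exact hyy (cr_trans v _ _ hv (h y hy) (h y' hy'))
  have key : ∀ T : Finset ι, T ⊆ S.erase k →
      ∃ x ∈ L, x k ≠ 0 ∧ (∀ j ∉ S, x j = 0) ∧ ∀ j ∈ T, x j = 0 := by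
    intro T
    induction T using Finset.induction_on with
    | empty =>
      intro _
      refine ⟨y, hy, ?_, hys, by simp⟩
      intro h
      simp [h] at hyy
    | insert j T hj ih =>
      intro hT
      obtain ⟨x, hx, hxk, hxS, hxT⟩ := ih (fun a ha => hT (Finset.mem_insert_of_mem ha))
      obtain ⟨z, hz, hzj, hzk⟩ := hc j (hT (Finset.mem_insert_self _ _))
      by_cases hp : x k ⨯₃ z k = 0
      · obtain ⟨w, hw, hwk⟩ := mv (z k) hzk
        refine ⟨_, hbr x hx _ (hbr z hz.1 w hw), cr_cr_par _ _ _ hxk hp hwk, ?_, ?_⟩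
        · intro i hi
          simp [hxS i hi]
        · intro i hi
          rcases Finset.mem_insert.mp hi with rfl | hi
          · simp [hzj]
          · simp [hxT i hi]
      · refine ⟨_, hbr x hx z hz.1, hp, ?_, ?_⟩
        · intro i hi
          simp [hxS i hi]
        · intro i hi
          rcases Finset.mem_insert.mp hi with rfl | hi
          · simp [hzj]
          · simp [hxT i hi]
  obtain ⟨x, hx, hxk, hxS, hxT⟩ := key _ subset_rfl
  have hx0 : ∀ j, j ≠ k → x j = 0 := by
    intro j hj
    by_cases hjS : j ∈ S
    · exact hxT j (Finset.mem_erase.mpr ⟨hj, hjS⟩)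
    · exact hxS j hjS
  obtain ⟨w, hw, hwk⟩ := mv (x k) hxk
  exact cr_cr_self _ _ hwk (hno k x hx _ (hbr x hx w hw) hx0 (fun j hj => by simp [hx0 j hj]))

lemma finrank_supp (L : Submodule ℝ (ι → Fin 3 → ℝ))
    (hbr : ∀ x ∈ L, ∀ y ∈ L, (fun k => x k ⨯₃ y k) ∈ L)
    (hno : ∀ k, ∀ x ∈ L, ∀ y ∈ L, (∀ j, j ≠ k → x j = 0) → (∀ j, j ≠ k → y j = 0) →
      x k ⨯₃ y k = 0) (m : ℕ) :
    ∀ S : Finset ι, S.card = m → 2 * Module.finrank ℝ (suppSub L S) ≤ 3 * S.card := by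
  induction m using Nat.strong_induction_on with
  | _ m ih =>
  intro S hS
  rcases S.eq_empty_or_nonempty with rfl | ⟨k, hk⟩
  · have : suppSub L ∅ = ⊥ := by
      rw [eq_bot_iff]
      rintro x ⟨_, hx⟩
      simp only [Submodule.mem_bot]
      ext1 k
      exact hx k (by simp)
    rw [this]
    simp
  · have hck := Finset.card_erase_of_mem hk
    have hcp : 0 < S.card := Finset.card_pos.mpr ⟨k, hk⟩
    by_cases hpar : ∀ x ∈ suppSub L S, ∀ y ∈ suppSub L S, x k ⨯₃ y k = 0
    · have h1 := finrank_step (LinearMap.proj k : (ι → Fin 3 → ℝ) →ₗ[ℝ] (Fin 3 → ℝ))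
        (suppSub L S) (suppSub L (S.erase k)) (by
          rintro x ⟨hx, hxS⟩ hxk
          refine ⟨hx, fun j hj => ?_⟩
          by_cases hjk : j = k
          · subst hjk; exact hxk
          · exact hxS j (fun h => hj (Finset.mem_erase.mpr ⟨hjk, h⟩)))
      have h2 := ih _ (by omega) (S.erase k) rfl
      have h3 : Module.finrank ℝ ((suppSub L S).map
          (LinearMap.proj k : (ι → Fin 3 → ℝ) →ₗ[ℝ] (Fin 3 → ℝ))) ≤ 1 := by
        by_cases hz : ∀ x ∈ suppSub L S, x k = 0
        · apply finrank_le_one 0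
          rintro ⟨_, x, hx, rfl⟩
          exact ⟨0, Subtype.ext (by simp [hz x hx])⟩
        · push Not at hz
          obtain ⟨v, hv, hvk⟩ := hz
          apply finrank_le_one (⟨v k, v, hv, rfl⟩ : (suppSub L S).map
            (LinearMap.proj k : (ι → Fin 3 → ℝ) →ₗ[ℝ] (Fin 3 → ℝ)))
          rintro ⟨_, x, hx, rfl⟩
          obtain ⟨c, hc⟩ := cr_smul (v k) (x k) hvk (hpar v hv x hx)
          exact ⟨c, Subtype.ext (by simpa using hc)⟩
      omega
    · push Not at hpar
      obtain ⟨y, hy, y', hy', hyy⟩ := hpar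
      obtain ⟨j, hj, hjk⟩ := exists_link L hbr hno k y y' hy.1 hy'.1 hyy S hy.2
      have hcj := Finset.card_erase_of_mem hj
      have hcp' : 0 < (S.erase k).card := Finset.card_pos.mpr ⟨j, hj⟩
      have h1 := finrank_step (LinearMap.proj j : (ι → Fin 3 → ℝ) →ₗ[ℝ] (Fin 3 → ℝ))
        (suppSub L S) (suppSub L ((S.erase k).erase j)) (by
          intro x hxx hxj
          refine ⟨hxx.1, fun i hi => ?_⟩
          by_cases hik : i = k
          · subst hik; exact hjk x hxx hxj
          by_cases hij : i = j
          · subst hij; exact hxj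
          · exact hxx.2 i (fun h => hi (Finset.mem_erase.mpr ⟨hij, Finset.mem_erase.mpr ⟨hik, h⟩⟩)))
      have h2 := ih _ (by omega) ((S.erase k).erase j) rfl
      have h3 := Submodule.finrank_le ((suppSub L S).map
          (LinearMap.proj j : (ι → Fin 3 → ℝ) →ₗ[ℝ] (Fin 3 → ℝ)))
      simp only [Module.finrank_fin_fun] at h3
      omega

lemma finrank_L (L : Submodule ℝ (ι → Fin 3 → ℝ))
    (hbr : ∀ x ∈ L, ∀ y ∈ L, (fun k => x k ⨯₃ y k) ∈ L)
    (hno : ∀ k, ∀ x ∈ L, ∀ y ∈ L, (∀ j, j ≠ k → x j = 0) → (∀ j, j ≠ k → y j = 0) →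
      x k ⨯₃ y k = 0) : 2 * Module.finrank ℝ L ≤ 3 * Fintype.card ι := by
  have h := finrank_supp L hbr hno _ Finset.univ rfl
  have : suppSub L Finset.univ = L := by
    ext x
    constructor
    · exact fun h => h.1
    · exact fun h => ⟨h, fun k hk => absurd (Finset.mem_univ k) hk⟩
  rw [this] at h
  simpa using h
end

section
variable {n : ℕ}

lemma bitFlip_self (k : Fin n) (I : Fin n → Fin 2) : bitFlip k (bitFlip k I) = I := by
  simp [bitFlip]

lemma bitFlip_same (k : Fin n) (I : Fin n → Fin 2) : bitFlip k I k = 1 - I k := by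
  simp [bitFlip]

lemma bitFlip_ne {k j : Fin n} (h : j ≠ k) (I : Fin n → Fin 2) : bitFlip k I j = I j := by
  simp [bitFlip, h]

lemma bitFlip_comm {k j : Fin n} (h : j ≠ k) (I : Fin n → Fin 2) :
    bitFlip k (bitFlip j I) = bitFlip j (bitFlip k I) := by
  simp only [bitFlip]
  rw [Function.update_of_ne h.symm, Function.update_of_ne h, Function.update_comm h]

/-- The operator of the vector `v` at qubit `k`. -/
noncomputable def Ek (k : Fin n) (v : Fin 3 → ℝ) : Module.End ℂ ((Fin n → Fin 2) → ℂ) where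
  toFun ψ := fun I => (v 0 : ℂ) * Aop k ψ I + (v 1 : ℂ) * Bop k ψ I + (v 2 : ℂ) * Cop k ψ I
  map_add' := by
    intro φ ψ
    ext I
    simp only [Aop, Bop, Cop, Pi.add_apply]
    ring
  map_smul' := by
    intro c ψ
    ext I
    simp only [Aop, Bop, Cop, Pi.smul_apply, smul_eq_mul, RingHom.id_apply]
    ring

lemma Ek_apply (k : Fin n) (v : Fin 3 → ℝ) (ψ : (Fin n → Fin 2) → ℂ) (I : Fin n → Fin 2) :
    Ek k v ψ I = (v 0 : ℂ) * (Complex.I * (-1 : ℂ) ^ ((I k : ℕ)) * ψ I) +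
      (v 1 : ℂ) * ((-1 : ℂ) ^ ((I k : ℕ)) * ψ (bitFlip k I)) +
      (v 2 : ℂ) * (Complex.I * ψ (bitFlip k I)) := rfl

lemma Ek_zero (k : Fin n) : Ek k 0 = 0 := by
  ext1 ψ
  ext I
  simp [Ek_apply]

lemma sgn_flip (a : Fin 2) : (-1 : ℂ) ^ ((1 - a : Fin 2) : ℕ) = - (-1 : ℂ) ^ (a : ℕ) := by
  fin_cases a <;> simp

lemma sgn_sq (a : Fin 2) : (-1 : ℂ) ^ (a : ℕ) * (-1 : ℂ) ^ (a : ℕ) = 1 := by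
  fin_cases a <;> simp

lemma Ek_bracket (k : Fin n) (v w : Fin 3 → ℝ) :
    Ek k v * Ek k w - Ek k w * Ek k v = (2 : ℂ) • Ek k (v ⨯₃ w) := by
  apply LinearMap.ext
  intro ψ
  ext I
  simp only [LinearMap.sub_apply, Module.End.mul_apply, LinearMap.smul_apply, Pi.sub_apply,
    Pi.smul_apply, Ek_apply, bitFlip_self, bitFlip_same, sgn_flip, smul_eq_mul, cross_apply]
  have h1 := sgn_sq (I k)
  have h2 := Complex.I_mul_I
  generalize (-1 : ℂ) ^ (I k : ℕ) = s at *
  generalize Complex.I = i at *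
  simp
  grind

lemma Ek_sq (k : Fin n) (v : Fin 3 → ℝ) (ψ : (Fin n → Fin 2) → ℂ) :
    Ek k v (Ek k v ψ) = (-((v 0 ^ 2 + v 1 ^ 2 + v 2 ^ 2 : ℝ) : ℂ)) • ψ := by
  ext I
  simp only [Pi.smul_apply, Ek_apply, bitFlip_self, bitFlip_same, sgn_flip, smul_eq_mul]
  have h1 := sgn_sq (I k)
  have h2 := Complex.I_mul_I
  generalize (-1 : ℂ) ^ (I k : ℕ) = s at *
  generalize Complex.I = i at *
  push_cast
  grind

lemma Ek_comm {j k : Fin n} (h : j ≠ k) (v w : Fin 3 → ℝ) :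
    Ek j v * Ek k w = Ek k w * Ek j v := by
  apply LinearMap.ext
  intro ψ
  ext I
  simp only [Module.End.mul_apply, Ek_apply, bitFlip_ne h, bitFlip_ne h.symm, bitFlip_comm h]
  ring

/-- The operator of an element of `su(2)^n`. -/
noncomputable def EE (x : Fin n → Fin 3 → ℝ) : Module.End ℂ ((Fin n → Fin 2) → ℂ) :=
  ∑ k, Ek k (x k)

lemma EE_bracket (x y : Fin n → Fin 3 → ℝ) :
    EE x * EE y - EE y * EE x = (2 : ℂ) • EE (fun k => x k ⨯₃ y k) := by
  simp only [EE, Finset.sum_mul_sum, Finset.smul_sum]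
  rw [Finset.sum_comm (f := fun i j => Ek i (y i) * Ek j (x j)), ← Finset.sum_sub_distrib]
  apply Finset.sum_congr rfl
  intro k _
  rw [← Finset.sum_sub_distrib, Finset.sum_eq_single k]
  · exact Ek_bracket k _ _
  · intro j _ hj
    rw [Ek_comm hj, sub_self]
  · simp

lemma EE_single (x : Fin n → Fin 3 → ℝ) (k : Fin n) (h : ∀ j, j ≠ k → x j = 0) :
    EE x = Ek k (x k) := by
  rw [EE, Finset.sum_eq_single k]
  · intro j _ hj
    rw [h j hj, Ek_zero]
  · simp

lemma EE_br_zero (ψ : (Fin n → Fin 2) → ℂ) (x y : Fin n → Fin 3 → ℝ) (a b : ℂ)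
    (hx : EE x ψ = a • ψ) (hy : EE y ψ = b • ψ) : EE (fun k => x k ⨯₃ y k) ψ = 0 := by
  have h := congrArg (fun f => f ψ) (EE_bracket x y)
  simp only [LinearMap.sub_apply, Module.End.mul_apply, LinearMap.smul_apply, hx, hy, map_smul] at h
  rw [smul_comm, sub_self] at h
  exact (smul_eq_zero.mp h.symm).resolve_left (by norm_num)

lemma Ek_add (k : Fin n) (v w : Fin 3 → ℝ) : Ek k (v + w) = Ek k v + Ek k w := by
  apply LinearMap.ext
  intro ψ
  ext I
  simp only [LinearMap.add_apply, Pi.add_apply, Ek_apply, Complex.ofReal_add]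
  ring

lemma Ek_smul (k : Fin n) (c : ℝ) (v : Fin 3 → ℝ) : Ek k (c • v) = (c : ℂ) • Ek k v := by
  apply LinearMap.ext
  intro ψ
  ext I
  simp only [LinearMap.smul_apply, Pi.smul_apply, Ek_apply, smul_eq_mul, Complex.ofReal_mul]
  ring

/-- The projective stabilizer algebra. -/
noncomputable def stabL (ψ : (Fin n → Fin 2) → ℂ) : Submodule ℝ (Fin n → Fin 3 → ℝ) where
  carrier := {x | ∃ a : ℂ, EE x ψ = a • ψ}
  zero_mem' := ⟨0, by simp [EE, Ek_zero]⟩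
  add_mem' := by
    rintro x y ⟨a, ha⟩ ⟨b, hb⟩
    refine ⟨a + b, ?_⟩
    rw [add_smul, ← ha, ← hb]
    simp [EE, Ek_add, Finset.sum_add_distrib]
  smul_mem' := by
    rintro c x ⟨a, ha⟩
    refine ⟨c * a, ?_⟩
    rw [mul_smul, ← ha]
    simp [EE, Ek_smul, Finset.smul_sum]

lemma stabL_finrank (ψ : (Fin n → Fin 2) → ℂ) (hψ : ψ ≠ 0) :
    2 * Module.finrank ℝ (stabL ψ) ≤ 3 * n := by
  have h := finrank_L (stabL ψ) ?_ ?_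
  · simpa using h
  · rintro x ⟨a, ha⟩ y ⟨b, hb⟩
    exact ⟨0, by rw [EE_br_zero ψ x y a b ha hb, zero_smul]⟩
  · rintro k x ⟨a, ha⟩ y ⟨b, hb⟩ hx hy
    have h := EE_br_zero ψ x y a b ha hb
    rw [EE_single _ k (fun j hj => by simp [hx j hj])] at h
    by_contra hne
    have h2 := Ek_sq k (x k ⨯₃ y k) ψ
    rw [h, map_zero] at h2
    have hp := dot_self_pos _ hne
    rcases smul_eq_zero.mp h2.symm with h3 | h3
    · rw [neg_eq_zero, Complex.ofReal_eq_zero] at h3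
      exact hp.ne' h3
    · exact hψ h3

/-- Real coordinates of a complex vector. -/
noncomputable def realify : ((Fin n → Fin 2) → ℂ) →ₗ[ℝ] ((Fin n → Fin 2) × Fin 2 → ℝ) where
  toFun φ := fun p => if p.2 = 0 then (φ p.1).re else (φ p.1).im
  map_add' := by
    intro φ ψ
    ext p
    by_cases h : p.2 = 0 <;> simp [h]
  map_smul' := by
    intro c ψ
    ext p
    by_cases h : p.2 = 0 <;> simp [h]

lemma realify_inj (φ : (Fin n → Fin 2) → ℂ) (h : realify φ = 0) : φ = 0 := by
  ext I
  have h0 := congrFun h (I, 0)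
  have h1 := congrFun h (I, 1)
  simp [realify] at h0 h1
  exact Complex.ext h0 h1

lemma Mmat_col (ψ : (Fin n → Fin 2) → ℂ) (c) : (Mmat ψ).col c = realify (colM ψ c) := rfl

lemma Mmat_mulVec (ψ : (Fin n → Fin 2) → ℂ) (x : (Fin n × Fin 3) ⊕ Unit → ℝ) :
    Mmat ψ *ᵥ x = realify (EE (fun k c => x (Sum.inl (k, c))) ψ
      - ((x (Sum.inr ()) : ℂ) * Complex.I) • ψ) := by
  have h1 : Mmat ψ *ᵥ x = realify (∑ c, x c • colM ψ c) := by
    ext p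
    simp only [map_sum, map_smul, Matrix.mulVec, dotProduct, Finset.sum_apply, Pi.smul_apply,
      smul_eq_mul, ← Mmat_col, Matrix.col_apply]
    exact Finset.sum_congr rfl (fun _ _ => mul_comm _ _)
  rw [h1]
  congr 1
  ext I
  simp [Fintype.sum_sum_type, Fintype.sum_prod_type, Fin.sum_univ_three, EE, colM,
    Finset.sum_apply, Ek, LinearMap.sum_apply]
  ring

lemma rank_lower (ψ : (Fin n → Fin 2) → ℂ) (hψ : ψ ≠ 0) : 3 * n + 2 ≤ 2 * (Mmat ψ).rank := by
  have h1 := LinearMap.finrank_range_add_finrank_ker (Mmat ψ).mulVecLin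
  have h2 : Module.finrank ℝ (LinearMap.ker (Mmat ψ).mulVecLin) ≤ Module.finrank ℝ (stabL ψ) := by
    let p : ((Fin n × Fin 3) ⊕ Unit → ℝ) →ₗ[ℝ] (Fin n → Fin 3 → ℝ) :=
      { toFun := fun x k c => x (Sum.inl (k, c))
        map_add' := fun _ _ => rfl
        map_smul' := fun _ _ => rfl }
    have hk : ∀ x ∈ LinearMap.ker (Mmat ψ).mulVecLin,
        EE (p x) ψ = ((x (Sum.inr ()) : ℂ) * Complex.I) • ψ := by
      intro x hx
      have h : Mmat ψ *ᵥ x = 0 := hx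
      rw [Mmat_mulVec] at h
      exact sub_eq_zero.mp (realify_inj _ h)
    let g : LinearMap.ker (Mmat ψ).mulVecLin →ₗ[ℝ] stabL ψ :=
      LinearMap.codRestrict (stabL ψ) (p ∘ₗ (LinearMap.ker (Mmat ψ).mulVecLin).subtype)
        (fun x => ⟨_, hk x.1 x.2⟩)
    apply LinearMap.finrank_le_finrank_of_injective (f := g)
    rw [injective_iff_map_eq_zero]
    intro x hx
    have hpx : p x.1 = 0 := congrArg Subtype.val hx
    have h := hk x.1 x.2
    rw [hpx] at h
    have h0 : (x.1 (Sum.inr ()) : ℂ) * Complex.I = 0 := by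
      refine (smul_eq_zero.mp (h.symm.trans ?_)).resolve_right hψ
      simp [EE, Ek_zero]
    have h00 : x.1 (Sum.inr ()) = 0 := by simpa using h0
    apply Subtype.ext
    ext c
    rcases c with ⟨k, c⟩ | c
    · exact congrFun (congrFun hpx k) c
    · exact h00
  have h3 := stabL_finrank ψ hψ
  have h4 : Module.finrank ℝ ((Fin n × Fin 3) ⊕ Unit → ℝ) = 3 * n + 1 := by
    simp
    ring
  rw [h4] at h1
  have h5 : (Mmat ψ).rank = Module.finrank ℝ (LinearMap.range (Mmat ψ).mulVecLin) := rfl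
  omega

lemma rank_upper {ι : Type} [Fintype ι] (ψ : (Fin n → Fin 2) → ℂ)
    (f : ι → (Fin n × Fin 3) ⊕ Unit)
    (h : ∀ c, (∃ i, colM ψ c = colM ψ (f i)) ∨ (∃ i, colM ψ c = - colM ψ (f i))) :
    (Mmat ψ).rank ≤ Fintype.card ι := by
  rw [Matrix.rank_eq_finrank_span_cols]
  refine le_trans ?_ (finrank_range_le_card (R := ℝ) (fun i => (Mmat ψ).col (f i)))
  apply Submodule.finrank_mono
  rw [Submodule.span_le]
  rintro _ ⟨c, rfl⟩
  rcases h c with ⟨i, hi⟩ | ⟨i, hi⟩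
  · rw [Mmat_col, hi, ← Mmat_col]
    exact Submodule.subset_span ⟨i, rfl⟩
  · rw [Mmat_col, hi, map_neg, ← Mmat_col]
    exact Submodule.neg_mem _ (Submodule.subset_span ⟨i, rfl⟩)

/-- the columns of a state that contains a singlet factor at qubits `a`, `b` -/
lemma singlet_cols (ψ R : (Fin n → Fin 2) → ℂ) (a b : Fin n) (hab : a ≠ b)
    (hψ : ∀ I, ψ I = singletC (I a) (I b) * R I)
    (ha : ∀ I, R (bitFlip a I) = R I) (hb : ∀ I, R (bitFlip b I) = R I) (c : Fin 3) :
    colM ψ (Sum.inl (b, c)) = - colM ψ (Sum.inl (a, c)) := by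
  have key : ∀ x : Fin 2, x = 0 ∨ x = 1 := by decide
  ext I
  fin_cases c <;> simp [colM, Aop, Bop, Cop, hψ, ha, hb, bitFlip_same, bitFlip_ne hab,
    bitFlip_ne hab.symm] <;>
  rcases key (I a) with h | h <;> rcases key (I b) with h' | h' <;> simp [h, h', singletC]

lemma singState_fac (j : Fin (n / 2)) : ∃ R : (Fin n → Fin 2) → ℂ,
    (∀ I, singState n I = singletC (I ⟨2 * j.val, by have := j.isLt; omega⟩)
      (I ⟨2 * j.val + 1, by have := j.isLt; omega⟩) * R I) ∧
    (∀ I, R (bitFlip ⟨2 * j.val, by have := j.isLt; omega⟩ I) = R I) ∧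
    (∀ I, R (bitFlip ⟨2 * j.val + 1, by have := j.isLt; omega⟩ I) = R I) := by
  have hj := j.isLt
  refine ⟨fun I => (∏ i ∈ Finset.univ.erase j,
    singletC (I ⟨2 * i.val, by have := i.isLt; omega⟩)
             (I ⟨2 * i.val + 1, by have := i.isLt; omega⟩)) *
    (if h : n % 2 = 1 then (if I ⟨n - 1, by omega⟩ = 0 then 1 else 0) else 1), ?_, ?_, ?_⟩
  · intro I
    rw [← mul_assoc]
    simp only [singState]
    rw [← Finset.mul_prod_erase Finset.univ _ (Finset.mem_univ j)]
  all_goals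
    intro I
    simp only
    congr 1
    · apply Finset.prod_congr rfl
      intro i hi
      have hij : i.val ≠ j.val := fun h => (Finset.mem_erase.mp hi).1 (Fin.ext h)
      rw [bitFlip_ne, bitFlip_ne] <;> (simp only [ne_eq, Fin.mk.injEq]; omega)
    · by_cases h : n % 2 = 1
      · simp only [h, dif_pos]
        rw [bitFlip_ne]
        simp only [ne_eq, Fin.mk.injEq]; omega
      · simp only [h, dif_neg, not_false_eq_true]

lemma singState_ne : singState n ≠ 0 := by
  intro h
  have h1 := congrFun h (fun k => if k.val % 2 = 0 then 0 else 1)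
  simp only [singState, Pi.zero_apply] at h1
  have h2 : ∀ j : ℕ, (2 * j) % 2 = 0 ∧ (2 * j + 1) % 2 = 1 := fun j => by omega
  simp [h2, singletC] at h1
  by_cases h3 : n % 2 = 1
  · have h4 : (n - 1) % 2 = 0 := by omega
    simp [h3, h4] at h1
  · simp [h3] at h1

lemma sing_pair (j : Fin (n / 2)) (c : Fin 3) :
    colM (singState n) (Sum.inl (⟨2 * j.val + 1, by have := j.isLt; omega⟩, c)) =
    - colM (singState n) (Sum.inl (⟨2 * j.val, by have := j.isLt; omega⟩, c)) := by
  obtain ⟨R, h, h1, h2⟩ := singState_fac j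
  exact singlet_cols _ R _ _ (by simp) h h1 h2 c

lemma sing_upper_even (hn : n % 2 = 0) : 2 * (Mmat (singState n)).rank ≤ 3 * n + 2 := by
  have h := rank_upper (ι := (Fin (n / 2) × Fin 3) ⊕ Unit) (singState n)
    (Sum.map (fun p => (⟨2 * p.1.val, by have := p.1.isLt; omega⟩, p.2)) id) ?_
  · simp only [Fintype.card_sum, Fintype.card_prod, Fintype.card_fin, Fintype.card_unit] at h
    omega
  · rintro (⟨k, c⟩ | u)
    · have hk := k.isLt
      rcases Nat.mod_two_eq_zero_or_one k.val with h | h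
      · left
        refine ⟨Sum.inl (⟨k.val / 2, by omega⟩, c), ?_⟩
        congr 3
        apply Fin.ext
        simp only
        omega
      · right
        refine ⟨Sum.inl (⟨k.val / 2, by omega⟩, c), ?_⟩
        have := sing_pair (⟨k.val / 2, by omega⟩ : Fin (n / 2)) c
        simp only [Sum.map_inl]
        rw [← this]
        congr 3
        apply Fin.ext
        simp only
        omega
    · left
      exact ⟨Sum.inr u, rfl⟩

lemma sing_last (hn : n % 2 = 1) :
    colM (singState n) (Sum.inl (⟨n - 1, by omega⟩, 0)) = - colM (singState n) (Sum.inr ()) := by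
  ext I
  simp only [colM, Aop, if_true, Pi.neg_apply, neg_neg]
  by_cases h : I ⟨n - 1, by omega⟩ = 0
  · simp [h]
  · simp [singState, hn, h]

lemma sing_upper_odd (hn : n % 2 = 1) : 2 * (Mmat (singState n)).rank ≤ 3 * n + 3 := by
  have h := rank_upper (ι := (Fin (n / 2) × Fin 3) ⊕ Fin 3) (singState n)
    (Sum.elim (fun p => Sum.inl (⟨2 * p.1.val, by have := p.1.isLt; omega⟩, p.2))
      (fun c => if c = 0 then Sum.inr () else Sum.inl (⟨n - 1, by omega⟩, c))) ?_
  · simp only [Fintype.card_sum, Fintype.card_prod, Fintype.card_fin] at h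
    omega
  · rintro (⟨k, c⟩ | u)
    · have hk := k.isLt
      by_cases hl : k.val = n - 1
      · have hkk : k = ⟨n - 1, by omega⟩ := Fin.ext hl
        rw [hkk]
        by_cases hc : c = 0
        · right
          refine ⟨Sum.inr 0, ?_⟩
          subst hc
          simpa using sing_last hn
        · left
          exact ⟨Sum.inr c, by simp [hc]⟩
      rcases Nat.mod_two_eq_zero_or_one k.val with h | h
      · left
        refine ⟨Sum.inl (⟨k.val / 2, by omega⟩, c), ?_⟩
        simp only [Sum.elim_inl]
        congr 3
        apply Fin.ext
        simp only
        omega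
      · right
        refine ⟨Sum.inl (⟨k.val / 2, by omega⟩, c), ?_⟩
        have := sing_pair (⟨k.val / 2, by omega⟩ : Fin (n / 2)) c
        simp only [Sum.elim_inl]
        rw [← this]
        congr 3
        apply Fin.ext
        simp only
        omega
    · left
      exact ⟨Sum.inr 0, by simp⟩

end

/-- minimum orbit dimension.  Since the orbit dimension of `[ψ]`
is `rank M - 1`, the claim is: for every nonzero `ψ`, `rank M ≥ 3n/2 + 1`
(`n` even) resp. `rank M ≥ (3n+1)/2 + 1` (`n` odd), and equality holds for the
product-of-singlets state (tensored with `|0⟩` for odd `n`).  Inequalities are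
stated multiplied by 2 to avoid division. -/
theorem minimum_orbit_dimension (n : ℕ) :
    (∀ ψ : (Fin n → Fin 2) → ℂ, ψ ≠ 0 →
      (Even n → 2 * (Mmat ψ).rank ≥ 3 * n + 2) ∧
      (Odd n → 2 * (Mmat ψ).rank ≥ (3 * n + 1) + 2)) ∧
    (singState n ≠ 0 ∧
      (Even n → 2 * (Mmat (singState n)).rank = 3 * n + 2) ∧
      (Odd n → 2 * (Mmat (singState n)).rank = (3 * n + 1) + 2)) := by
  refine ⟨fun ψ hψ => ?_, singState_ne, ?_, ?_⟩
  · have h := rank_lower ψ hψ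
    refine ⟨fun _ => h, fun ho => ?_⟩
    obtain ⟨m, hm⟩ := ho
    omega
  · intro he
    have h := rank_lower _ (singState_ne (n := n))
    have h' := sing_upper_even (Nat.even_iff.mp he)
    omega
  · intro ho
    have h := rank_lower _ (singState_ne (n := n))
    have h' := sing_upper_odd (Nat.odd_iff.mp ho)
    have := Nat.odd_iff.mp ho
    omega
end
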